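/- Under the standing hypotheses on q, λ, Φ_q, Φ_{q+λ}, W, f, K_c, K_p listed in the context, assume ā₂ < ā₁ and hypothesis (★). Then it is impossible that both lim_{b→∞} ρ_{ā₂}(b) = −∞ and lim_{b→∞} Γ(ā₂, b) = −∞ (these limits exist in [−∞, 0] and [−∞, ∞) respectively, since b ↦ ρ_{ā₂}(b) is non-increasing and non-positive). -/

import Mathlib

open MeasureTheory Filter Set Real

noncomputable section

/-- Tilted inventory-cost derivative integrand against the scale function:
`ρ_a(b) = ∫_a^b g(y) W(b - y) dy`. -/
def rho (W g : ℝ → ℝ) (a b : ℝ) : ℝ :=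
  ∫ y in a..b, g y * W (b - y)

/-- `Γ(a, b)` of the paper (display (Gamma)). -/
def Gam (lam Phiq Kp Kc : ℝ) (W g : ℝ → ℝ) (a b : ℝ) : ℝ :=
  (∫ y in Set.Ioi (0:ℝ), Real.exp (-Phiq * y) * g (y + a)) +
    lam * (∫ y in (0:ℝ)..(b - a), Real.exp (-Phiq * y) * rho W g a (y + a)) +
    lam / Phiq * Real.exp (-Phiq * (b - a)) * (Kp - Kc)

/-- `Γ₁(a) = Γ(a, a+)`. -/
def Gam1 (lam Phiq Kp Kc : ℝ) (g : ℝ → ℝ) (a : ℝ) : ℝ :=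
  (∫ y in Set.Ioi (0:ℝ), Real.exp (-Phiq * y) * g (y + a)) + lam / Phiq * (Kp - Kc)

/-- `Γ₂(a) = lim_{b→∞} Γ(a,b)/Θ(b-a)`. -/
def Gam2 (Phiql : ℝ) (g : ℝ → ℝ) (a : ℝ) : ℝ :=
  ∫ y in Set.Ioi (0:ℝ), Real.exp (-Phiql * y) * g (y + a)

/-- `Θ(x) = Θ^{(q+λ)}(x, Φ(q))`. -/
def Theta (lam Phiq : ℝ) (W : ℝ → ℝ) (x : ℝ) : ℝ :=
  1 + lam * (∫ y in (0:ℝ)..x, Real.exp (-Phiq * y) * W y)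

/-- `γ(a,b) = -ρ_a(b) + K_p - K_c`. -/
def gam (Kp Kc : ℝ) (W g : ℝ → ℝ) (a b : ℝ) : ℝ :=
  -(rho W g a b) + Kp - Kc

/-- `Z(x) = Z^{(q+λ)}(x) = 1 + (q+λ)∫₀^{x ∨ 0} W(y) dy`. -/
def Zfun (q lam : ℝ) (W : ℝ → ℝ) (x : ℝ) : ℝ :=
  1 + (q + lam) * (∫ y in (0:ℝ)..(max x 0), W y)

/-- Second scale function `Ẑ(x) = Z^{(q+λ)}(x, Φ(q))`. -/
def Zhat (lam Phiq : ℝ) (W : ℝ → ℝ) (x : ℝ) : ℝ :=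
  Real.exp (Phiq * x) *
    (1 + lam * (∫ z in (0:ℝ)..(max x 0), Real.exp (-Phiq * z) * W z))

theorem ConvexOn.monotone_of_hasDerivWithinAt_Ici {f f' : ℝ → ℝ} (hf : ConvexOn ℝ univ f)
    (hf' : ∀ x, HasDerivWithinAt f (f' x) (Ici x) x) : Monotone f' := by
  intro x y hxy
  rcases hxy.eq_or_lt with rfl | hlt
  · exact le_rfl
  have key : ∀ z, y < z → f' x ≤ slope f y z := fun z hz =>
    (hf.le_slope_of_hasDerivWithinAt_Ioi (mem_univ x) (mem_univ y) hlt
      ((hf' x).mono Ioi_subset_Ici_self)).trans (by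
      simpa [slope_def_field] using hf.slope_mono_adjacent (mem_univ x) (mem_univ z) hlt hz)
  refine ge_of_tendsto ((hasDerivWithinAt_iff_tendsto_slope' self_notMem_Ioi).mp
    ((hf' y).mono Ioi_subset_Ici_self)) ?_
  filter_upwards [self_mem_nhdsWithin] with z hz using key z hz

theorem ConvexOn.isBigO_exp_of_growth {f f' : ℝ → ℝ} (hf : ConvexOn ℝ univ f)
    (hf' : ∀ x, HasDerivWithinAt f (f' x) (Ici x) x)
    (hgrowth : ∃ C M : ℝ, ∃ N : ℕ, 0 < C ∧ 0 < M ∧ ∀ x : ℝ, M < |x| → |f x| ≤ C * |x| ^ N)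
    {c : ℝ} (hc : 0 < c) : f' =O[atTop] fun x => exp (c * x) := by
  obtain ⟨C, M, N, -, -, h⟩ := hgrowth
  have hfO : f =O[atTop] fun x => exp (c * x) := by
    refine Asymptotics.IsBigO.trans ?_ (isLittleO_pow_exp_pos_mul_atTop N hc).isBigO
    refine Asymptotics.IsBigO.of_bound C ?_
    filter_upwards [eventually_gt_atTop M] with x hx
    simpa using h x (hx.trans_le (le_abs_self x))
  have hfO1 : (fun x => f (x + 1)) =O[atTop] fun x => exp (c * x) := by
    refine (hfO.comp_tendsto (tendsto_atTop_add_const_right _ 1 tendsto_id)).trans ?_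
    refine Asymptotics.IsBigO.of_bound (exp c) (Eventually.of_forall fun x => ?_)
    simp only [Function.comp_def, id, norm_eq_abs, abs_exp, ← exp_add]
    exact le_of_eq (by ring_nf)
  have hconst : (fun _ : ℝ => f' 0) =O[atTop] fun x => exp (c * x) :=
    Asymptotics.IsLittleO.isBigO <| Asymptotics.isLittleO_const_left.2 <| Or.inr <| by
      simpa [Function.comp_def] using tendsto_id.const_mul_atTop hc
  have hsum := (hconst.norm_left.add ((hfO1.sub hfO).norm_left))
  refine Asymptotics.IsBigO.trans (Asymptotics.IsBigO.of_bound 1 ?_) hsum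
  filter_upwards [eventually_ge_atTop 0] with x hx
  have h1 := hf.monotone_of_hasDerivWithinAt_Ici hf' hx
  have h2 := hf.le_slope_of_hasDerivWithinAt_Ioi (mem_univ x) (mem_univ (x + 1)) (by linarith)
      ((hf' x).mono Ioi_subset_Ici_self)
  simp only [slope_def_field, add_sub_cancel_left, div_one] at h2
  simp only [norm_eq_abs, one_mul]
  rw [abs_of_nonneg (add_nonneg (abs_nonneg (f' 0)) (abs_nonneg (f (x + 1) - f x)))]
  rw [abs_le]
  constructor <;> linarith [neg_abs_le (f' 0), abs_nonneg (f' 0), le_abs_self (f (x + 1) - f x),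
    abs_nonneg (f (x + 1) - f x)]

theorem Monotone.integrableOn_exp_mul {g : ℝ → ℝ} (hg : Monotone g) {c r : ℝ} (hcr : c < r)
    (hO : g =O[atTop] fun x => exp (c * x)) (a : ℝ) :
    IntegrableOn (fun y => exp (-r * y) * g y) (Ioi a) := by
  have hloc : LocallyIntegrable (fun y => exp (-r * y) * g y) :=
    hg.locallyIntegrable.continuous_smul (by fun_prop : Continuous fun y => exp (-r * y))
  refine IntegrableOn.mono_set (t := Ici a) ?_ Ioi_subset_Ici_self
  refine (hloc.locallyIntegrableOn _).integrableOn_of_isBigO_atTop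
    (g := fun y => exp ((c - r) * y)) ?_
    ⟨Ioi a, Ioi_mem_atTop a, integrableOn_exp_mul_Ioi (by linarith) a⟩
  refine ((Asymptotics.isBigO_refl (fun y => exp (-r * y)) atTop).mul hO).congr_right fun y => ?_
  rw [← exp_add]; ring_nf

theorem Gam2_eq_exp_mul_integral (r : ℝ) (g : ℝ → ℝ) (a : ℝ) :
    Gam2 r g a = exp (r * a) * ∫ y in Ioi a, exp (-r * y) * g y := by
  have h := (measurePreserving_add_right volume a).setIntegral_preimage_emb
    (measurableEmbedding_addRight a) (fun y => exp (-r * y) * g y) (Ioi a)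
  rw [← h, ← integral_const_mul, Gam2]
  simp only [preimage_add_const_Ioi, sub_self, ← mul_assoc, ← exp_add]
  congr 1; ext y; ring_nf

/-- The infimum of `{a | 0 ≤ Gam2 r g a}` is attained. -/
theorem Gam2_sInf_nonneg {r : ℝ} {g : ℝ → ℝ} (hr : 0 < r) (hg : Monotone g)
    (hint : ∀ a, IntegrableOn (fun y => exp (-r * y) * g y) (Ioi a))
    (hne : {a : ℝ | 0 ≤ g a}.Nonempty) (hbdd : BddBelow {a : ℝ | 0 ≤ g a}) :
    0 ≤ ∫ y in Ioi (sInf {a : ℝ | 0 ≤ Gam2 r g a}), exp (-r * y) * g y := by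
  set G : ℝ → ℝ := fun a => ∫ y in Ioi a, exp (-r * y) * g y with hG
  have hset : {a : ℝ | 0 ≤ Gam2 r g a} = {a | 0 ≤ G a} := by
    ext a
    simp only [mem_ofPred_eq, Gam2_eq_exp_mul_integral, hG]
    exact mul_nonneg_iff_of_pos_left (exp_pos _)
  have hsub : ∀ a b, G a - G b = ∫ y in a..b, exp (-r * y) * g y := fun a b =>
    intervalIntegral.integral_Ioi_sub_Ioi' (hint a) (hint b)
  have hloc : LocallyIntegrable (fun y => exp (-r * y) * g y) :=
    hg.locallyIntegrable.continuous_smul (by fun_prop : Continuous fun y => exp (-r * y))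
  have hii : ∀ a b, IntervalIntegrable (fun y => exp (-r * y) * g y) volume a b := fun a b =>
    (hloc.integrableOn_isCompact isCompact_uIcc).intervalIntegrable
  have hcont : Continuous G := by
    have : G = fun b => G 0 - ∫ y in (0 : ℝ)..b, exp (-r * y) * g y := by
      ext b; rw [← hsub]; ring
    rw [this]
    exact continuous_const.sub (intervalIntegral.continuous_primitive hii 0)
  rw [hset]
  refine (isClosed_le continuous_const hcont).csInf_mem ?_ ?_
  · obtain ⟨x, hx⟩ := hne
    refine ⟨x, setIntegral_nonneg measurableSet_Ioi fun y hy => ?_⟩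
    exact mul_nonneg (exp_pos _).le (le_trans hx (hg (le_of_lt hy)))
  · obtain ⟨m, hm⟩ := hbdd
    have hneg : ∀ x < m, g x < 0 := fun x hx => by
      by_contra! h
      exact absurd (hm h) (not_le.2 hx)
    set x₀ := m - 1
    have hx₀ : g x₀ < 0 := hneg _ (by simp [x₀])
    set k := exp (-r * x₀) * g x₀ with hk
    have hk0 : k < 0 := mul_neg_of_pos_of_neg (exp_pos _) hx₀
    refine ⟨min x₀ (x₀ + G x₀ / k), fun a ha => ?_⟩
    by_contra! hlt
    have hax : a < x₀ := hlt.trans_le (min_le_left _ _)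
    have hax' : a < x₀ + G x₀ / k := hlt.trans_le (min_le_right _ _)
    have hle : (∫ y in a..x₀, exp (-r * y) * g y) ≤ ∫ _ in a..x₀, k := by
      refine intervalIntegral.integral_mono_on hax.le (hii _ _) (by simp) fun y hy => ?_
      have h1 : exp (-r * x₀) ≤ exp (-r * y) := exp_le_exp.2 (by nlinarith [hy.2])
      have h2 := hg hy.2
      nlinarith [exp_pos (-r * y)]
    rw [intervalIntegral.integral_const, smul_eq_mul, ← hsub] at hle
    have ha0 : 0 ≤ G a := ha
    have : (a - x₀) * k > G x₀ := by
      have := mul_lt_mul_of_neg_right (sub_lt_iff_lt_add'.2 hax') hk0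
      rwa [div_mul_cancel₀ _ hk0.ne] at this
    linarith

theorem monotone_of_strictMonoOn_Ici {W : ℝ → ℝ} (hW0 : ∀ x < (0 : ℝ), W x = 0)
    (hWnn : ∀ x ≥ (0 : ℝ), 0 ≤ W x) (hWmono : StrictMonoOn W (Ici 0)) : Monotone W := by
  intro x y hxy
  rcases lt_or_ge x 0 with hx | hx
  · rw [hW0 x hx]
    rcases lt_or_ge y 0 with hy | hy
    · exact (hW0 y hy).ge
    · exact hWnn y hy
  · exact hWmono.monotoneOn hx (hx.trans hxy) hxy

theorem continuousAt_of_ne_zero {W : ℝ → ℝ} (hW0 : ∀ x < (0 : ℝ), W x = 0)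
    (hWcont : ContinuousOn W (Ici 0)) {x : ℝ} (hx : x ≠ 0) : ContinuousAt W x := by
  rcases hx.lt_or_gt with hx | hx
  · exact continuousAt_const.congr (by
      filter_upwards [Iio_mem_nhds hx] with y hy using (hW0 y hy).symm)
  · exact hWcont.continuousAt (Ici_mem_nhds hx)

theorem exists_bound_exp_mul {W : ℝ → ℝ} {r L : ℝ} (hr : 0 < r) (hW0 : ∀ x < (0 : ℝ), W x = 0)
    (hWnn : ∀ x, 0 ≤ W x) (hWmono : Monotone W)
    (hL : Tendsto (fun x => exp (-r * x) * W x) atTop (nhds L)) :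
    ∃ M, ∀ z, |exp (-r * z) * W z| ≤ M := by
  obtain ⟨X, hX⟩ := eventually_atTop.1 (hL.eventually (eventually_le_nhds (lt_add_one L)))
  refine ⟨max (L + 1) (W X), fun z => ?_⟩
  rw [abs_of_nonneg (mul_nonneg (exp_pos _).le (hWnn z))]
  rcases le_total X z with h | h
  · exact le_max_of_le_left (hX z h)
  refine le_max_of_le_right ?_
  rcases lt_or_ge z 0 with hz | hz
  · simpa [hW0 z hz] using hWnn X
  · calc exp (-r * z) * W z ≤ 1 * W z := by
          gcongr
          · exact hWnn z
          · exact exp_le_one_iff.2 (by nlinarith)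
      _ ≤ W X := by simpa using hWmono h

/-- Splitting off the factor `exp (r * b)` turns `rho` into an integral over a fixed half-line. -/
theorem rho_eq_exp_mul_integral {W g : ℝ → ℝ} (r : ℝ) (hW0 : ∀ x < (0 : ℝ), W x = 0) (a b : ℝ) :
    rho W g a b = exp (r * b) *
      ∫ y in Ioi a, exp (-r * y) * g y * (exp (-r * (b - y)) * W (b - y)) := by
  have hpt : ∀ y, exp (r * b) * (exp (-r * y) * g y * (exp (-r * (b - y)) * W (b - y))) =
      g y * W (b - y) := fun y => by
    have : exp (r * b) * exp (-r * y) * exp (-r * (b - y)) = 1 := by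
      rw [← exp_add, ← exp_add, exp_eq_one_iff]; ring
    linear_combination (g y * W (b - y)) * this
  rw [← integral_const_mul]
  simp only [hpt, rho]
  rcases le_total a b with hab | hab
  · rw [intervalIntegral.integral_of_le hab]
    refine (setIntegral_eq_of_subset_of_forall_sdiff_eq_zero measurableSet_Ioi
      Ioc_subset_Ioi_self fun y hy => ?_).symm
    rw [hW0 _ (by
      have : ¬ y ≤ b := fun h => hy.2 ⟨hy.1, h⟩
      linarith), mul_zero]
  · rw [intervalIntegral.integral_of_ge hab, setIntegral_eq_zero_of_forall_eq_zero
      (t := Ioi a) fun y hy => by rw [hW0 _ (by linarith [mem_Ioi.1 hy]), mul_zero]]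
    rw [neg_eq_zero, integral_Ioc_eq_integral_Ioo]
    exact setIntegral_eq_zero_of_forall_eq_zero fun y hy => by
      rw [hW0 _ (by linarith [hy.1]), mul_zero]

theorem continuous_rho {W g : ℝ → ℝ} {r M : ℝ} (hW0 : ∀ x < (0 : ℝ), W x = 0)
    (hWcont : ContinuousOn W (Ici 0)) (hWmono : Monotone W)
    (hM : ∀ z, |exp (-r * z) * W z| ≤ M) {a : ℝ}
    (hint : IntegrableOn (fun y => exp (-r * y) * g y) (Ioi a)) :
    Continuous (rho W g a) := by
  rw [funext (rho_eq_exp_mul_integral r hW0 a)]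
  refine (by fun_prop : Continuous fun b => exp (r * b)).mul ?_
  have hmeas := hWmono.measurable
  refine continuous_iff_continuousAt.2 fun b => continuousAt_of_dominated
    (bound := fun y => |exp (-r * y) * g y| * M) ?_ ?_ (hint.abs.mul_const M) ?_
  · refine Eventually.of_forall fun x => hint.aestronglyMeasurable.mul ?_
    exact Measurable.aestronglyMeasurable (by fun_prop)
  · refine Eventually.of_forall fun x => Eventually.of_forall fun y => ?_
    rw [norm_mul, norm_eq_abs, norm_eq_abs]
    exact mul_le_mul_of_nonneg_left (hM _) (abs_nonneg _)
  · have : ∀ᵐ y ∂(volume.restrict (Ioi a)), y ≠ b := by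
      refine ae_restrict_of_ae ?_
      simp [ae_iff]
    filter_upwards [this] with y hy
    have h1 : ContinuousAt (fun x => W (x - y)) b :=
      ContinuousAt.comp (f := fun x => x - y) (g := W)
        (continuousAt_of_ne_zero hW0 hWcont (sub_ne_zero.2 hy.symm)) (by fun_prop)
    exact continuousAt_const.mul ((by fun_prop : ContinuousAt (fun x => exp (-r * (x - y))) b).mul h1)

theorem tendsto_exp_mul_rho {W g : ℝ → ℝ} {r M L : ℝ} (hW0 : ∀ x < (0 : ℝ), W x = 0)
    (hWmono : Monotone W) (hM : ∀ z, |exp (-r * z) * W z| ≤ M)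
    (hL : Tendsto (fun x => exp (-r * x) * W x) atTop (nhds L)) {a : ℝ}
    (hint : IntegrableOn (fun y => exp (-r * y) * g y) (Ioi a)) :
    Tendsto (fun b => exp (-r * b) * rho W g a b) atTop
      (nhds ((∫ y in Ioi a, exp (-r * y) * g y) * L)) := by
  have hmeas := hWmono.measurable
  have heq : (fun b => exp (-r * b) * rho W g a b) = fun b =>
      ∫ y in Ioi a, exp (-r * y) * g y * (exp (-r * (b - y)) * W (b - y)) := by
    ext b
    rw [rho_eq_exp_mul_integral r hW0 a, ← mul_assoc, ← exp_add]
    simp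
  rw [heq, ← integral_mul_const]
  refine tendsto_integral_filter_of_dominated_convergence
    (fun y => |exp (-r * y) * g y| * M) ?_ ?_ (hint.abs.mul_const M) ?_
  · refine Eventually.of_forall fun x => hint.aestronglyMeasurable.mul ?_
    exact Measurable.aestronglyMeasurable (by fun_prop)
  · refine Eventually.of_forall fun x => Eventually.of_forall fun y => ?_
    rw [norm_mul, norm_eq_abs, norm_eq_abs]
    exact mul_le_mul_of_nonneg_left (hM _) (abs_nonneg _)
  · refine Eventually.of_forall fun y => tendsto_const_nhds.mul ?_
    exact hL.comp (tendsto_atTop_add_const_right _ (-y) tendsto_id)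

theorem hasDerivAt_integral_of_continuousOn_Ici {w : ℝ → ℝ} (hw : ContinuousOn w (Ici 0)) {x : ℝ}
    (hx : 0 < x) : HasDerivAt (fun u => ∫ y in (0 : ℝ)..u, w y) (w x) x := by
  refine intervalIntegral.integral_hasDerivAt_right ?_ ?_ (hw.continuousAt (Ici_mem_nhds hx))
  · refine (hw.mono ?_).intervalIntegrable
    rw [uIcc_of_le hx.le]
    exact Icc_subset_Ici_self
  · exact (hw.mono Ioi_subset_Ici_self).stronglyMeasurableAtFilter isOpen_Ioi x hx

/-- If `U = lam * ∫ exp (-p * y) * s y - C` and `s * P ≥ p * Z * U` eventually, where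
`P = (lam + q) * Theta - lam * exp (-p * x) * Z`, then `s` dominates a positive multiple of `Z`. -/
theorem exists_mul_Zfun_le {q lam p C x₀ : ℝ} {W s : ℝ → ℝ} (hq : 0 < q) (hlam : 0 < lam)
    (hp : 0 < p) (hW : ContinuousOn W (Ici 0)) (hWnn : ∀ x, 0 ≤ W x) (hs : Continuous s)
    (hx₀ : 0 < x₀) (hU : 0 < lam * (∫ y in (0 : ℝ)..x₀, exp (-p * y) * s y) - C)
    (hineq : ∀ x ≥ x₀, p * Zfun q lam W x * (lam * (∫ y in (0 : ℝ)..x, exp (-p * y) * s y) - C) ≤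
      s x * ((lam + q) * Theta lam p W x - lam * exp (-p * x) * Zfun q lam W x)) :
    ∃ k > 0, ∀ x ≥ x₀, k * Zfun q lam W x ≤ s x := by
  set U : ℝ → ℝ := fun x => lam * (∫ y in (0 : ℝ)..x, exp (-p * y) * s y) - C with hUdef
  set P : ℝ → ℝ := fun x => (lam + q) * Theta lam p W x - lam * exp (-p * x) * Zfun q lam W x
    with hPdef
  have hZ1 : ∀ x, 1 ≤ Zfun q lam W x := fun x => by
    have : 0 ≤ ∫ y in (0 : ℝ)..(max x 0), W y :=
      intervalIntegral.integral_nonneg (le_max_right _ _) fun y _ => hWnn y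
    unfold Zfun
    nlinarith
  have hexpW : ContinuousOn (fun y => exp (-p * y) * W y) (Ici 0) :=
    (by fun_prop : Continuous fun y => exp (-p * y)).continuousOn.mul hW
  have hUd : ∀ x > 0, HasDerivAt U (lam * (exp (-p * x) * s x)) x := fun x hx =>
    ((hasDerivAt_integral_of_continuousOn_Ici (by fun_prop) hx).const_mul lam).sub_const C
  have hTd : ∀ x > 0, HasDerivAt (Theta lam p W) (lam * (exp (-p * x) * W x)) x := fun x hx =>
    ((hasDerivAt_integral_of_continuousOn_Ici hexpW hx).const_mul lam).const_add 1
  have hZd : ∀ x > 0, HasDerivAt (Zfun q lam W) ((q + lam) * W x) x := fun x hx => by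
    refine (((hasDerivAt_integral_of_continuousOn_Ici hW hx).const_mul
      (q + lam)).const_add 1).congr_of_eventuallyEq ?_
    filter_upwards [Ioi_mem_nhds hx] with y hy
    rw [Zfun, max_eq_left (le_of_lt hy)]
  have hed : ∀ x, HasDerivAt (fun x => lam * exp (-p * x)) (-(lam * p * exp (-p * x))) x :=
    fun x => ((((hasDerivAt_id x).const_mul (-p)).exp).const_mul lam).congr_deriv (by
      simp only [id]
      ring)
  have hPd : ∀ x > 0, HasDerivAt P (lam * p * exp (-p * x) * Zfun q lam W x) x := fun x hx =>
    (((hTd x hx).const_mul (lam + q)).sub ((hed x).mul (hZd x hx))).congr_deriv (by ring)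
  have hPcont : ContinuousOn P (Ici 0) := by
    have hprim : ∀ w : ℝ → ℝ, ContinuousOn w (Ici 0) →
        ContinuousOn (fun x => ∫ y in (0 : ℝ)..x, w y) (Ici 0) := fun w hw x hx => by
      have := intervalIntegral.continuousOn_primitive_interval (μ := volume)
        (a := 0) (b := x + 1) (f := w) (by
        refine ContinuousOn.integrableOn_compact isCompact_uIcc (hw.mono ?_)
        rw [uIcc_of_le (by linarith [mem_Ici.1 hx])]
        exact Icc_subset_Ici_self)
      rw [uIcc_of_le (by linarith [mem_Ici.1 hx])] at this
      refine (this x ⟨hx, by linarith⟩).mono_of_mem_nhdsWithin ?_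
      exact mem_nhdsWithin.2 ⟨Iio (x + 1), isOpen_Iio, by simp, fun y hy => ⟨hy.2, le_of_lt hy.1⟩⟩
    have hT : ContinuousOn (Theta lam p W) (Ici 0) :=
      continuousOn_const.add (continuousOn_const.mul (hprim _ hexpW))
    have hZ : ContinuousOn (Zfun q lam W) (Ici 0) := by
      refine (((hprim W hW).const_mul (q + lam)).const_add 1).congr fun x hx => ?_
      rw [Zfun, max_eq_left hx]
    exact (continuousOn_const.mul hT).sub
      ((by fun_prop : Continuous fun x => lam * exp (-p * x)).continuousOn.mul hZ)
  have hPmono : MonotoneOn P (Ici 0) := by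
    refine monotoneOn_of_hasDerivWithinAt_nonneg (convex_Ici 0) hPcont
      (f' := fun x => lam * p * exp (-p * x) * Zfun q lam W x) ?_ ?_
    · intro x hx
      rw [interior_Ici] at hx
      exact (hPd x hx).hasDerivWithinAt
    · intro x _
      have := hZ1 x
      positivity
  have hPpos : ∀ x ≥ 0, 0 < P x := fun x hx => by
    have h0 : P 0 = q := by simp [hPdef, Theta, Zfun]
    have := hPmono (mem_Ici.2 le_rfl) (mem_Ici.2 hx) hx
    linarith
  have hd : ∀ x ≥ x₀, HasDerivAt (fun x => U x / P x)
      ((lam * (exp (-p * x) * s x) * P x - U x * (lam * p * exp (-p * x) * Zfun q lam W x)) /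
        P x ^ 2) x := fun x hx =>
    (hUd x (hx₀.trans_le hx)).div (hPd x (hx₀.trans_le hx)) (hPpos x (hx₀.le.trans hx)).ne'
  have hmono : MonotoneOn (fun x => U x / P x) (Ici x₀) := by
    refine monotoneOn_of_hasDerivWithinAt_nonneg (convex_Ici x₀)
      (fun x hx => (hd x hx).continuousAt.continuousWithinAt)
      (fun x hx => (hd x (interior_subset hx)).hasDerivWithinAt) fun x hx => ?_
    refine div_nonneg ?_ (sq_nonneg _)
    have h1 := hineq x (interior_subset hx)
    have h2 : 0 < lam * exp (-p * x) := by positivity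
    have h3 := mul_le_mul_of_nonneg_left h1 h2.le
    linarith
  refine ⟨p * (U x₀ / P x₀), mul_pos hp (div_pos hU (hPpos x₀ hx₀.le)), fun x hx => ?_⟩
  have hPx := hPpos x (hx₀.le.trans hx)
  have h1 : U x₀ / P x₀ ≤ U x / P x := hmono (mem_Ici.2 le_rfl) hx hx
  rw [le_div_iff₀ hPx] at h1
  refine le_of_mul_le_mul_right ?_ hPx
  have h2 := mul_le_mul_of_nonneg_left h1 (mul_nonneg hp.le (zero_le_one.trans (hZ1 x)))
  linarith [hineq x hx]

theorem mul_le_Zfun {q lam : ℝ} {W : ℝ → ℝ} (hqlam : 0 ≤ q + lam) (hWnn : ∀ x, 0 ≤ W x)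
    (hWmono : Monotone W) {x : ℝ} (hx : 1 ≤ x) : (q + lam) * W (x - 1) ≤ Zfun q lam W x := by
  have hii : ∀ a b, IntervalIntegrable W volume a b := fun a b => hWmono.intervalIntegrable
  have h1 : W (x - 1) ≤ ∫ y in (x - 1)..x, W y := by
    have := intervalIntegral.integral_mono_on (μ := volume) (f := fun _ => W (x - 1)) (g := W)
      (sub_le_self x zero_le_one) (by simp) (hii _ _) fun y hy => hWmono hy.1
    simpa using this
  have h2 := intervalIntegral.integral_add_adjacent_intervals (hii 0 (x - 1)) (hii (x - 1) x)
  have h3 : 0 ≤ ∫ y in (0 : ℝ)..(x - 1), W y :=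
    intervalIntegral.integral_nonneg (by linarith) fun y _ => hWnn y
  rw [Zfun, max_eq_left (zero_le_one.trans hx)]
  nlinarith [mul_le_mul_of_nonneg_left (show W (x - 1) ≤ ∫ y in (0 : ℝ)..x, W y by linarith) hqlam]

/-- Along `b = a + x`, positivity of the expression in the limit hypothesis is a differential
inequality for `x ↦ ∫ exp (-p * y) * rho W g a (y + a)`. -/
theorem mul_Zfun_mul_le_of_pos {q lam p Kp Kc a x : ℝ} {W g : ℝ → ℝ} (hq : 0 < q) (hlam : 0 < lam)
    (hp : 0 < p) (hK : Kp < Kc) (hWnn : ∀ x, 0 ≤ W x) (hx : 0 ≤ x)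
    (hpos : 0 < (p / q * Gam lam p Kp Kc W g a (x + a)
              - lam / q * exp (-p * (x + a - a)) * gam Kp Kc W g a (x + a))
            * Zfun q lam W (x + a - a) / Theta lam p W (x + a - a)
          + (lam + q) / q * gam Kp Kc W g a (x + a)) :
    p * Zfun q lam W x * (lam * (∫ y in (0 : ℝ)..x, exp (-p * y) * -rho W g a (y + a)) -
        ∫ y in Ioi (0 : ℝ), exp (-p * y) * g (y + a)) ≤
      -rho W g a (x + a) * ((lam + q) * Theta lam p W x - lam * exp (-p * x) * Zfun q lam W x) := by
  have hT : 0 < Theta lam p W x := by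
    have : 0 ≤ ∫ y in (0 : ℝ)..x, exp (-p * y) * W y :=
      intervalIntegral.integral_nonneg hx fun y _ => mul_nonneg (exp_pos _).le (hWnn y)
    unfold Theta
    nlinarith
  have hneg : (∫ y in (0 : ℝ)..x, exp (-p * y) * -rho W g a (y + a)) =
      -∫ y in (0 : ℝ)..x, exp (-p * y) * rho W g a (y + a) := by
    simp only [mul_neg, intervalIntegral.integral_neg]
  have hmul := mul_pos hpos (mul_pos hq hT)
  rw [hneg]
  simp only [add_sub_cancel_right, Gam, gam] at hmul
  field_simp at hmul
  simp only [neg_mul]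
  nlinarith [mul_pos (add_pos hlam hq) (mul_pos hT (sub_pos.2 hK))]

/-- Lemma 5.9 (impossibility of case (3)) of the paper. -/
theorem case_three_impossible
    (q lam Phiq Phiql : ℝ) (hq : 0 < q) (hlam : 0 < lam)
    (hPhiq : 0 < Phiq) (hPhi : Phiq < Phiql)
    (W : ℝ → ℝ)
    (hW0 : ∀ x < (0:ℝ), W x = 0)
    (hWnn : ∀ x ≥ (0:ℝ), 0 ≤ W x)
    (hWcont : ContinuousOn W (Set.Ici 0))
    (hWmono : StrictMonoOn W (Set.Ici 0))
    (hWC1 : ContDiffOn ℝ 1 W (Set.Ioi 0))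
    (hWratio_mono : ∀ a y : ℝ, a < y →
      MonotoneOn (fun b => W (b - y) / W (b - a)) (Set.Ioi y))
    (hWratio_lim : ∀ a y : ℝ, a < y →
      Filter.Tendsto (fun b => W (b - y) / W (b - a)) Filter.atTop
        (nhds (Real.exp (-Phiql * (y - a)))))
    (hWasymp : ∃ L : ℝ, 0 < L ∧
      Filter.Tendsto (fun x => Real.exp (-Phiql * x) * W x) Filter.atTop (nhds L))
    (f f' : ℝ → ℝ)
    (hf_conv : ConvexOn ℝ Set.univ f)
    (hf_deriv : ∀ x : ℝ, HasDerivWithinAt f (f' x) (Set.Ici x) x)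
    (hf_pw : ∃ E : Set ℝ, E.Countable ∧ ∀ x ∉ E, ContinuousAt f' x)
    (hf_growth : ∃ C M : ℝ, ∃ N : ℕ, 0 < C ∧ 0 < M ∧
      ∀ x : ℝ, M < |x| → |f x| ≤ C * |x| ^ N)
    (Kc Kp : ℝ) (hK : Kp < Kc)
    (g : ℝ → ℝ) (hg : ∀ x : ℝ, g x = f' x + q * Kc + lam * (Kc - Kp))
    (habar_ne : {a : ℝ | 0 ≤ g a}.Nonempty)
    (habar_bdd : BddBelow {a : ℝ | 0 ≤ g a})
    (habb_ne : {a : ℝ | 0 < f' a + q * Kp}.Nonempty)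
    (habb_bdd : BddBelow {a : ℝ | 0 < f' a + q * Kp})
    (a1 a2 : ℝ)
    (ha1 : a1 = sInf {a : ℝ | 0 ≤ Gam1 lam Phiq Kp Kc g a})
    (ha2 : a2 = sInf {a : ℝ | 0 ≤ Gam2 Phiql g a})
    (ha21 : a2 < a1)
    (hstar :
      Filter.Tendsto (fun b =>
          (Phiq / q * Gam lam Phiq Kp Kc W g a2 b
              - lam / q * Real.exp (-Phiq * (b - a2)) * gam Kp Kc W g a2 b)
            * Zfun q lam W (b - a2) / Theta lam Phiq W (b - a2)
          + (lam + q) / q * gam Kp Kc W g a2 b) Filter.atTop Filter.atTop ∨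
      ∃ L : ℝ, 0 < L ∧ Filter.Tendsto (fun b =>
          (Phiq / q * Gam lam Phiq Kp Kc W g a2 b
              - lam / q * Real.exp (-Phiq * (b - a2)) * gam Kp Kc W g a2 b)
            * Zfun q lam W (b - a2) / Theta lam Phiq W (b - a2)
          + (lam + q) / q * gam Kp Kc W g a2 b) Filter.atTop (nhds L))
    :
    ¬ (Filter.Tendsto (fun b => rho W g a2 b) Filter.atTop Filter.atBot ∧
       Filter.Tendsto (fun b => Gam lam Phiq Kp Kc W g a2 b) Filter.atTop Filter.atBot) := by
  rintro ⟨-, hGam⟩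
  obtain ⟨L, hL0, hL⟩ := hWasymp
  have hr : 0 < Phiql := hPhiq.trans hPhi
  have hWm : Monotone W := monotone_of_strictMonoOn_Ici hW0 hWnn hWmono
  have hWnn' : ∀ x, 0 ≤ W x := fun x => by
    rcases lt_or_ge x 0 with hx | hx
    exacts [(hW0 x hx).ge, hWnn x hx]
  obtain ⟨M, hM⟩ := exists_bound_exp_mul hr hW0 hWnn' hWm hL
  have hgm : Monotone g := fun x y hxy => by
    rw [hg, hg]
    linarith [hf_conv.monotone_of_hasDerivWithinAt_Ici hf_deriv hxy]
  have hgO : g =O[atTop] fun x => exp (Phiql / 2 * x) := by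
    rw [funext hg]
    have hc : ∀ c : ℝ, (fun _ : ℝ => c) =O[atTop] fun x => exp (Phiql / 2 * x) := fun c =>
      Asymptotics.IsLittleO.isBigO <| Asymptotics.isLittleO_const_left.2 <| Or.inr <| by
        simpa [Function.comp_def] using tendsto_id.const_mul_atTop (half_pos hr)
    exact ((hf_conv.isBigO_exp_of_growth hf_deriv hf_growth (half_pos hr)).add (hc _)).add (hc _)
  have hint := hgm.integrableOn_exp_mul (half_lt_self hr) hgO
  have hG : 0 ≤ ∫ y in Ioi a2, exp (-Phiql * y) * g y :=
    ha2 ▸ Gam2_sInf_nonneg hr hgm hint habar_ne habar_bdd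
  have hshift : Tendsto (fun x : ℝ => x + a2) atTop atTop :=
    tendsto_atTop_add_const_right _ a2 tendsto_id
  have hpos := hstar.elim (fun h => h.eventually_gt_atTop 0)
    fun ⟨_, h0, h⟩ => h.eventually (eventually_gt_nhds h0)
  obtain ⟨x₁, hx₁⟩ := eventually_atTop.1 (hshift.eventually hpos)
  obtain ⟨x₀, ⟨hx₀, hx₁₀⟩, hGx₀⟩ := (((eventually_gt_atTop 0).and (eventually_ge_atTop x₁)).and
    ((hGam.comp hshift).eventually_lt_atBot (-(lam / Phiq * (Kc - Kp))))).exists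
  obtain ⟨k, hk, hkZ⟩ := exists_mul_Zfun_le (q := q) (x₀ := x₀)
    (s := fun y => -rho W g a2 (y + a2)) hq hlam hPhiq hWcont hWnn'
    ((continuous_rho hW0 hWcont hWm hM (hint a2)).comp (continuous_add_const a2)).neg hx₀
    (C := ∫ y in Ioi (0 : ℝ), exp (-Phiq * y) * g (y + a2)) (by
      simp only [mul_neg, intervalIntegral.integral_neg]
      simp only [Function.comp_def, Gam, add_sub_cancel_right] at hGx₀
      have hE : exp (-Phiq * x₀) ≤ 1 := exp_le_one_iff.2 (by nlinarith)
      have hc : 0 < lam / Phiq * (Kc - Kp) := mul_pos (div_pos hlam hPhiq) (sub_pos.2 hK)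
      nlinarith)
    fun x hx => mul_Zfun_mul_le_of_pos hq hlam hPhiq hK hWnn' (hx₀.le.trans hx)
      (hx₁ x (hx₁₀.trans hx))
  have hleft : Tendsto (fun x => k * (q + lam) * exp (-Phiql) *
      (exp (-Phiql * (x - 1)) * W (x - 1))) atTop
      (nhds (k * (q + lam) * exp (-Phiql) * L)) :=
    (hL.comp (tendsto_atTop_add_const_right _ (-1) tendsto_id)).const_mul _
  have hright := ((tendsto_exp_mul_rho hW0 hWm hM hL (hint a2)).comp hshift).const_mul
    (-exp (Phiql * a2))
  have hle := le_of_tendsto_of_tendsto hleft hright (by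
    filter_upwards [eventually_ge_atTop x₀, eventually_ge_atTop 1] with x hx hx1
    have h1 := (mul_le_mul_of_nonneg_left
      (mul_le_Zfun (add_pos hq hlam).le hWnn' hWm hx1) hk.le).trans (hkZ x hx)
    have h2 := mul_le_mul_of_nonneg_left h1 (exp_pos (-Phiql * x)).le
    have h3 : exp (-Phiql) * exp (-Phiql * (x - 1)) = exp (-Phiql * x) := by
      rw [← exp_add]; ring_nf
    have h4 : exp (Phiql * a2) * exp (-Phiql * (x + a2)) = exp (-Phiql * x) := by
      rw [← exp_add]; ring_nf
    simp only [Function.comp_def]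
    linear_combination h2 + k * (q + lam) * W (x - 1) * h3 + rho W g a2 (x + a2) * h4)
  have h5 : 0 < k * (q + lam) * exp (-Phiql) * L := by positivity
  have h6 : 0 ≤ exp (Phiql * a2) * ((∫ y in Ioi a2, exp (-Phiql * y) * g y) * L) := by positivity
  linarith
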